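/- arXiv:2511.12833 — 11 statements merged into one kernel-verified Lean document; each statement's English description precedes it below -/
import Mathlib

section
/- A traceless 2×2 complex matrix H is pseudo-Hermitian if and only if its Hermitian part H₊ := (H + H†)/2 and the Hermitian matrix H₋ := (H − H†)/(2i) anti-commute, i.e. H₊H₋ + H₋H₊ = 0. -/
open Matrix

/-- An N×N complex matrix `H` is pseudo-Hermitian if there exists an invertible
Hermitian matrix `η` (a metric operator) such that `η H = Hᴴ η`. -/
def PseudoHermitian {N : ℕ} (H : Matrix (Fin N) (Fin N) ℂ) : Prop :=
  ∃ η : Matrix (Fin N) (Fin N) ℂ, η.IsHermitian ∧ IsUnit η ∧ η * H = Hᴴ * η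

/-- A traceless 2×2 complex matrix is pseudo-Hermitian iff its Hermitian part
`H₊ = (H + Hᴴ)/2` and the Hermitian matrix `H₋ = (H − Hᴴ)/(2i)` anti-commute. -/
theorem stmt0 (H : Matrix (Fin 2) (Fin 2) ℂ) (htr : H.trace = 0) :
    PseudoHermitian H ↔
      ((2 : ℂ)⁻¹ • (H + Hᴴ)) * ((2 * Complex.I)⁻¹ • (H - Hᴴ)) +
        ((2 * Complex.I)⁻¹ • (H - Hᴴ)) * ((2 : ℂ)⁻¹ • (H + Hᴴ)) = 0 := by
  have hd : H 1 1 = - H 0 0 := by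
    rw [Matrix.trace_fin_two] at htr
    linear_combination htr
  have hsq : H * H = (-H.det) • (1 : Matrix (Fin 2) (Fin 2) ℂ) := by
    ext i j
    fin_cases i <;> fin_cases j <;>
      simp [Matrix.mul_apply, Fin.sum_univ_two, Matrix.det_fin_two, hd] <;> ring
  have hsq' : Hᴴ * Hᴴ = (-star H.det) • (1 : Matrix (Fin 2) (Fin 2) ℂ) := by
    rw [← Matrix.conjTranspose_mul, hsq, Matrix.conjTranspose_smul, Matrix.conjTranspose_one,
      star_neg]
  have hI : (2 * Complex.I)⁻¹ * (2 : ℂ)⁻¹ ≠ 0 := by simp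
  have key : ((2 : ℂ)⁻¹ • (H + Hᴴ)) * ((2 * Complex.I)⁻¹ • (H - Hᴴ)) +
        ((2 * Complex.I)⁻¹ • (H - Hᴴ)) * ((2 : ℂ)⁻¹ • (H + Hᴴ)) =
      ((2 * Complex.I)⁻¹ * (2 : ℂ)⁻¹) • ((2 : ℂ) • (H * H - Hᴴ * Hᴴ)) := by
    simp only [smul_mul_smul_comm]
    rw [mul_comm (2 : ℂ)⁻¹, ← smul_add]
    congr 1
    rw [two_smul]
    noncomm_ring
  rw [key, smul_eq_zero, smul_eq_zero, or_iff_right hI, or_iff_right (two_ne_zero), sub_eq_zero]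
  constructor
  · rintro ⟨η, -, hu, he⟩
    have h1 := congrArg Matrix.det he
    rw [Matrix.det_mul, Matrix.det_mul, Matrix.det_conjTranspose, mul_comm] at h1
    have h2 : η.det ≠ 0 := ((Matrix.isUnit_iff_isUnit_det η).1 hu).ne_zero
    rw [hsq, hsq', ← mul_right_cancel₀ h2 h1]
  · intro h
    by_cases h0 : H + Hᴴ = 0
    · have hH : Hᴴ = -H := (neg_eq_of_add_eq_zero_right h0).symm
      have e00 : star (H 0 0) = - H 0 0 := by simpa using congrFun (congrFun hH 0) 0
      have e01 : star (H 0 1) = - H 1 0 := by simpa using congrFun (congrFun hH 1) 0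
      have e10 : star (H 1 0) = - H 0 1 := by simpa using congrFun (congrFun hH 0) 1
      by_cases hc : H 0 1 = 0
      · have hc' : H 1 0 = 0 := by simpa [hc] using e01
        refine ⟨!![0, 1; 1, 0], ?_, ?_, ?_⟩
        · ext i j
          fin_cases i <;> fin_cases j <;> simp
        · rw [Matrix.isUnit_iff_isUnit_det]
          simp [Matrix.det_fin_two]
        · rw [hH]
          ext i j
          fin_cases i <;> fin_cases j <;>
            simp [Matrix.mul_apply, Fin.sum_univ_two, hd, hc, hc']
      · have hc' : H 1 0 ≠ 0 := by
          intro h'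
          rw [h', neg_zero, star_eq_zero] at e01
          exact hc e01
        refine ⟨!![0, H 0 1; - H 1 0, 0], ?_, ?_, ?_⟩
        · ext i j
          simp only [RCLike.star_def] at e01 e10
          fin_cases i <;> fin_cases j <;> simp [e01, e10]
        · rw [Matrix.isUnit_iff_isUnit_det]
          simp [Matrix.det_fin_two, hc, hc']
        · rw [hH]
          ext i j
          fin_cases i <;> fin_cases j <;>
            simp [Matrix.mul_apply, Fin.sum_univ_two, hd] <;> ring
    · refine ⟨H + Hᴴ, ?_, ?_, ?_⟩
      · exact Matrix.isHermitian_add_transpose_self H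
      · rw [Matrix.isUnit_iff_isUnit_det, isUnit_iff_ne_zero]
        intro hdet
        apply h0
        have hre := congrArg Complex.re hdet
        simp [Matrix.det_fin_two, hd] at hre
        have a1 : (H 0 0).re = 0 := by nlinarith [sq_nonneg ((H 0 1).re + (H 1 0).re), sq_nonneg ((H 0 1).im - (H 1 0).im)]
        have a2 : (H 0 1).re + (H 1 0).re = 0 := by nlinarith [sq_nonneg ((H 0 0).re), sq_nonneg ((H 0 1).im - (H 1 0).im)]
        have a3 : (H 0 1).im - (H 1 0).im = 0 := by nlinarith [sq_nonneg ((H 0 0).re), sq_nonneg ((H 0 1).re + (H 1 0).re)]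
        ext i j
        fin_cases i <;> fin_cases j <;> apply Complex.ext <;> simp [hd] <;> linarith
      · rw [add_mul, mul_add, h, add_comm]
end

section
/- The matrix ηx is Hermitian and invertible and satisfies (ηx) H = H† (ηx), so H is pseudo-Hermitian; moreover the matrix M := η + iγ η x⁻¹ y satisfies M H = H† M. -/
open Matrix ComplexOrder

/-- With `x y = −y x`, `x` invertible, `y² = 1`, `η` positive-definite Hermitian with
`η x = xᴴ η`, `η y = yᴴ η`, `γ ∈ ℝ` and `H = x + iγ y`: the matrix `η x` is Hermitian,
invertible and satisfies `(η x) H = Hᴴ (η x)`, so `H` is pseudo-Hermitian; moreover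
`M = η + iγ η x⁻¹ y` satisfies `M H = Hᴴ M`. -/
theorem stmt3 {N : ℕ} (hN : 0 < N) (x y η : Matrix (Fin N) (Fin N) ℂ)
    (hxy : x * y = -(y * x)) (hx : IsUnit x) (hy2 : y ^ 2 = 1)
    (hη : η.PosDef) (hηx : η * x = xᴴ * η) (hηy : η * y = yᴴ * η)
    (γ : ℝ) :
    (η * x).IsHermitian ∧ IsUnit (η * x) ∧
    (η * x) * (x + (Complex.I * (γ : ℂ)) • y) =
      (x + (Complex.I * (γ : ℂ)) • y)ᴴ * (η * x) ∧
    PseudoHermitian (x + (Complex.I * (γ : ℂ)) • y) ∧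
    (η + (Complex.I * (γ : ℂ)) • (η * x⁻¹ * y)) * (x + (Complex.I * (γ : ℂ)) • y) =
      (x + (Complex.I * (γ : ℂ)) • y)ᴴ * (η + (Complex.I * (γ : ℂ)) • (η * x⁻¹ * y)) := by
  have hηH : ηᴴ = η := hη.isHermitian
  set c : ℂ := Complex.I * (γ : ℂ) with hc
  have hcs : star c = -c := by simp [hc]
  have key : (x + c • y)ᴴ * η = η * (x - c • y) := by
    rw [conjTranspose_add, conjTranspose_smul, hcs, add_mul, smul_mul_assoc, ← hηx, ← hηy,
      mul_sub, mul_smul_comm, neg_smul, sub_eq_add_neg]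
  have h1 : (η * x).IsHermitian := by
    unfold Matrix.IsHermitian
    rw [conjTranspose_mul, hηH, hηx]
  have h2 : IsUnit (η * x) := hη.isUnit.mul hx
  have h3 : (η * x) * (x + c • y) = (x + c • y)ᴴ * (η * x) := by
    rw [← mul_assoc, key, mul_assoc, mul_assoc]
    congr 1
    rw [mul_add, sub_mul, mul_smul_comm, smul_mul_assoc, hxy, smul_neg, sub_eq_add_neg]
  refine ⟨h1, h2, h3, ⟨η * x, h1, h2, h3⟩, ?_⟩
  have hd : IsUnit x.det := (Matrix.isUnit_iff_isUnit_det x).1 hx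
  have hxi : x * x⁻¹ = 1 := Matrix.mul_nonsing_inv x hd
  have hix : x⁻¹ * x = 1 := Matrix.nonsing_inv_mul x hd
  have hyy : y * y = 1 := by rw [← pow_two, hy2]
  have ha : x⁻¹ * y * x = -y := by
    have : y * x = -(x * y) := by rw [hxy, neg_neg]
    rw [mul_assoc, this, mul_neg, ← mul_assoc, hix, one_mul]
  have hb : y * x⁻¹ = -(x⁻¹ * y) := by
    have : y = -(x⁻¹ * y * x) := by rw [ha, neg_neg]
    calc y * x⁻¹ = -(x⁻¹ * y * x) * x⁻¹ := by rw [← this]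
      _ = -(x⁻¹ * y) := by rw [neg_mul, mul_assoc, hxi, mul_one]
  have hM : η + c • (η * x⁻¹ * y) = η * (1 + c • (x⁻¹ * y)) := by
    rw [mul_add, mul_one, mul_smul_comm, mul_assoc]
  rw [hM, ← mul_assoc, key, mul_assoc, mul_assoc]
  congr 1
  have e1 : x⁻¹ * y * y = x⁻¹ := by rw [mul_assoc, hyy, mul_one]
  have e2 : x * (x⁻¹ * y) = y := by rw [← mul_assoc, hxi, one_mul]
  have e3 : y * (x⁻¹ * y) = -x⁻¹ := by rw [← mul_assoc, hb, neg_mul, e1]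
  simp only [mul_add, add_mul, sub_mul, one_mul, mul_one, smul_mul_assoc, mul_smul_comm, ha, e1,
    e2, e3, smul_neg]
  abel
end

section
/- Let G be a simple graph on a finite nonempty vertex set V that is a tree (connected and acyclic), and let T be a V×V complex matrix such that T_{uv} = 0 whenever u and v are not adjacent in G (in particular all diagonal entries vanish), and such that for every edge {u,v} of G the product T_{uv} T_{vu} is a positive real number. Then for every vertex r ∈ V there exists a unique diagonal matrix η with positive real diagonal entries satisfying η_{rr} = 1 and η T = T† η. In particular T is quasi-Hermitian. -/
open Matrix ComplexOrder

noncomputable def wlkWeight {V : Type} {G : SimpleGraph V} (c : V → V → ℝ) :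
    ∀ {u v : V}, G.Walk u v → ℝ
  | _, _, .nil => 1
  | _, _, .cons (u := u) (v := v) _ p => c v u * wlkWeight c p

theorem wlkWeight_pos {V : Type} {G : SimpleGraph V} (c : V → V → ℝ)
    (hc : ∀ u v, G.Adj u v → 0 < c v u) {u v : V} (p : G.Walk u v) : 0 < wlkWeight c p := by
  induction p with
  | nil => simp [wlkWeight]
  | cons h p ih => exact mul_pos (hc _ _ h) ih

theorem exists_weight {V : Type} (G : SimpleGraph V) (hG : G.IsTree) (r : V) (c : V → V → ℝ)
    (hc : ∀ u v, G.Adj u v → 0 < c v u) (hinv : ∀ u v, G.Adj u v → c u v * c v u = 1) :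
    ∃ g : V → ℝ, (∀ v, 0 < g v) ∧ g r = 1 ∧ ∀ u v, G.Adj u v → g u = c v u * g v := by
  classical
  choose P hP hU using fun v => hG.existsUnique_path v r
  refine ⟨fun v => wlkWeight c (P v), fun v => wlkWeight_pos c hc _, ?_, ?_⟩
  · show wlkWeight c (P r) = 1
    rw [← hU r .nil (by simp)]
    rfl
  · have key : ∀ u v, G.Adj u v → u ∉ (P v).support →
        wlkWeight c (P u) = c v u * wlkWeight c (P v) := by
      intro u v h hn
      rw [← hU u (.cons h (P v)) ((hP v).cons hn)]
      rfl
    intro u v h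
    by_cases hn : u ∈ (P v).support
    · have h2 : v ∉ (P u).support := by
        have h3 := hG.IsAcyclic.ne_mem_support_of_support_of_adj_of_isPath (hP v).reverse
          (hP u).reverse h.symm (by simpa using hn)
        simpa using h3
      show wlkWeight c (P u) = c v u * wlkWeight c (P v)
      rw [key v u h.symm h2, ← mul_assoc, mul_comm (c v u), hinv u v h, one_mul]
    · exact key u v h hn

theorem entry_iff {V : Type} [Fintype V] [DecidableEq V] (T η : Matrix V V ℂ) (hd : η.IsDiag) :
    η * T = Tᴴ * η ↔ ∀ u v, η u u * T u v = star (T v u) * η v v := by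
  obtain ⟨d, rfl⟩ : ∃ d, η = diagonal d := ⟨_, hd.diagonal_diag.symm⟩
  rw [← Matrix.ext_iff]
  simp [Matrix.diagonal_mul, Matrix.mul_diagonal]

theorem exists_real {V : Type} [Fintype V] [DecidableEq V]
    (G : SimpleGraph V) (hG : G.IsTree)
    (T : Matrix V V ℂ)
    (hsupp : ∀ u v, ¬ G.Adj u v → T u v = 0)
    (hpos : ∀ u v, G.Adj u v → 0 < (T u v * T v u).re ∧ (T u v * T v u).im = 0) (r : V) :
    ∃ g : V → ℝ, (∀ v, 0 < g v) ∧ g r = 1 ∧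
      diagonal (fun v => (g v : ℂ)) * T = Tᴴ * diagonal (fun v => (g v : ℂ)) := by
  have hne : ∀ u v, G.Adj u v → T u v ≠ 0 := by
    intro u v h h0
    have := (hpos u v h).1
    simp [h0] at this
  have hn : ∀ u v, G.Adj u v → 0 < ‖T u v‖ := fun u v h => norm_pos_iff.2 (hne u v h)
  obtain ⟨g, g0, g1, g2⟩ := exists_weight G hG r (fun u v => ‖T u v‖ / ‖T v u‖)
    (fun u v h => div_pos (hn v u h.symm) (hn u v h))
    (fun u v h => by
      have := (hn u v h).ne'
      have := (hn v u h.symm).ne'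
      field_simp)
  refine ⟨g, g0, g1, ?_⟩
  rw [entry_iff _ _ (Matrix.isDiag_diagonal _)]
  intro u v
  simp only [diagonal_apply_eq]
  by_cases h : G.Adj u v
  · have hb := hn v u h.symm
    have e1 : g u * ‖T u v‖ = ‖T v u‖ * g v := by
      have ha := hn u v h
      rw [g2 u v h]; field_simp
    have e2 : T u v * T v u = ((‖T u v‖ * ‖T v u‖ : ℝ) : ℂ) := by
      rw [← norm_mul]
      have hp := hpos u v h
      have : T u v * T v u = (((T u v * T v u).re : ℝ) : ℂ) := by
        apply Complex.ext <;> simp [-Complex.mul_re, -Complex.mul_im, hp.2]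
      rw [this, Complex.norm_real, Real.norm_of_nonneg]
      exact hp.1.le
    have e3 : star (T v u) * T v u = ((‖T v u‖ * ‖T v u‖ : ℝ) : ℂ) := by
      rw [Complex.star_def, ← Complex.normSq_eq_conj_mul_self, Complex.normSq_eq_norm_sq, sq]
    apply mul_right_cancel₀ (hne v u h.symm)
    rw [mul_assoc, e2, mul_right_comm, e3]
    norm_cast
    linear_combination ‖T v u‖ * e1
  · rw [hsupp u v h, hsupp v u (fun h' => h h'.symm)]; simp

theorem stmt4 {V : Type} [Fintype V] [DecidableEq V] [Nonempty V]
    (G : SimpleGraph V) (hG : G.IsTree)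
    (T : Matrix V V ℂ)
    (hsupp : ∀ u v, ¬ G.Adj u v → T u v = 0)
    (hpos : ∀ u v, G.Adj u v → 0 < (T u v * T v u).re ∧ (T u v * T v u).im = 0) :
    (∀ r : V, ∃! η : Matrix V V ℂ,
        η.IsDiag ∧ (∀ v, 0 < (η v v).re ∧ (η v v).im = 0) ∧ η r r = 1 ∧
          η * T = Tᴴ * η) ∧
    ∃ η : Matrix V V ℂ, η.PosDef ∧ η * T = Tᴴ * η := by
  constructor
  · intro r
    obtain ⟨g, g0, g1, g2⟩ := exists_real G hG T hsupp hpos r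
    refine ⟨_, ⟨Matrix.isDiag_diagonal _, fun v => ?_, ?_, g2⟩, ?_⟩
    · simpa using g0 v
    · simp [g1]
    · rintro η ⟨hd, -, h1, h2⟩
      rw [entry_iff _ _ hd] at h2
      rw [entry_iff _ _ (Matrix.isDiag_diagonal _)] at g2
      have main : ∀ u v, G.Walk u v → η v v = (g v : ℂ) → η u u = (g u : ℂ) := by
        intro u v p
        induction p with
        | nil => exact id
        | @cons a b _ h p ih =>
          intro hr
          have ha := h2 a b
          have hb := g2 a b
          simp only [diagonal_apply_eq] at hb
          rw [ih hr, ← hb] at ha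
          refine mul_right_cancel₀ ?_ ha
          intro h0
          have := (hpos a b h).1
          simp [h0] at this
      rw [← hd.diagonal_diag]
      congr 1
      funext v
      obtain ⟨p⟩ := hG.1.preconnected v r
      exact main v r p (by rw [h1, g1]; simp)
  · obtain ⟨g, g0, -, g2⟩ := exists_real G hG T hsupp hpos (Classical.arbitrary V)
    refine ⟨_, Matrix.PosDef.diagonal (fun v => ?_), g2⟩
    simpa using g0 v
end

section
/- Assume additionally that yⁿ = I. Let γ ∈ ℂ, set H = x + γ y, and let λ ≠ 0 be an eigenvalue of x. Then for every μ ∈ ℂ with μⁿ = λⁿ + γⁿ, the geometric multiplicity of μ as an eigenvalue of H is at least the geometric multiplicity of λ as an eigenvalue of x: μ_g(μ, H) ≥ μ_g(λ, x). -/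
open Matrix

/-- The geometric multiplicity of `μ` as an eigenvalue of `A`:
the dimension of `ker (μ • 1 − A)`. -/
noncomputable def geomMult {N : ℕ} (A : Matrix (Fin N) (Fin N) ℂ) (μ : ℂ) : ℕ :=
  Module.finrank ℂ (LinearMap.ker (μ • (1 : Matrix (Fin N) (Fin N) ℂ) - A).mulVecLin)

lemma aux_prod {n : ℕ} (hn : 0 < n) {q : ℂ} (hq : IsPrimitiveRoot q n) (m l : ℂ) :
    ∏ j ∈ Finset.range n, (m - l * q ^ (j+1)) = m ^ n - l ^ n := by
  have h1 : ∏ j ∈ Finset.range n, (m - l * q ^ (j+1)) =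
      ∏ j ∈ Finset.range n, (m - q ^ j * (l * q)) :=
    Finset.prod_congr rfl fun j _ => by ring
  have h2 := X_pow_sub_C_eq_prod (R := ℂ) hq hn (α := l * q) (a := l ^ n)
    (by rw [mul_pow, hq.pow_eq_one, mul_one])
  have h3 := congrArg (Polynomial.eval m) h2
  rw [Polynomial.eval_prod] at h3
  simp at h3
  rw [h1, h3]

lemma aux_c {n : ℕ} (hn : 0 < n) {q : ℂ} (hq : IsPrimitiveRoot q n) (g m l : ℂ) (hl : l ≠ 0)
    (h : m ^ n = l ^ n + g ^ n) :
    ∃ c : ℕ → ℂ, (∃ k < n, c k ≠ 0) ∧ c n = c 0 ∧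
      ∀ k < n, (m - l * q ^ (k+1)) * c (k+1) = g * c k := by
  have hp := aux_prod hn hq m l
  rw [h, add_sub_cancel_left] at hp
  by_cases hg : g = 0
  · subst hg
    classical
    refine ⟨fun k => if m = l * q ^ k then 1 else 0, ?_, ?_, ?_⟩
    · have hp2 : ∏ j ∈ Finset.range n, (m - l * q ^ (j+1)) = 0 := by
        rw [hp, zero_pow hn.ne']
      obtain ⟨j, hj, hj2⟩ := Finset.prod_eq_zero_iff.1 hp2
      refine ⟨(j+1) % n, Nat.mod_lt _ hn, ?_⟩
      have : q ^ ((j+1) % n) = q ^ (j+1) := by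
        conv_rhs => rw [← Nat.div_add_mod (j+1) n, pow_add, pow_mul, hq.pow_eq_one, one_pow, one_mul]
      simp only [this]
      rw [if_pos (sub_eq_zero.1 hj2)]
      exact one_ne_zero
    · simp [hq.pow_eq_one]
    · intro k _
      by_cases hk : m = l * q ^ (k+1)
      · simp [← hk]
      · simp [hk]
  · have hne : ∀ j < n, m - l * q ^ (j+1) ≠ 0 := by
      intro j hj h0
      have := Finset.prod_eq_zero (f := fun j => m - l * q ^ (j+1)) (Finset.mem_range.2 hj) h0
      rw [hp] at this
      exact hg (pow_eq_zero_iff hn.ne' |>.1 this)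
    refine ⟨fun k => ∏ j ∈ Finset.range k, (g / (m - l * q ^ (j+1))), ⟨0, hn, by simp⟩, ?_, ?_⟩
    · simp only [Finset.prod_div_distrib, hp]
      simp [hg]
    · intro k hk
      have := hne k hk
      simp only [Finset.prod_range_succ]
      field_simp

/-- Let `q` be a primitive n-th root of unity, `x y = q y x`, `yⁿ = 1`, `γ ∈ ℂ` and
`H = x + γ y`.  If `λ ≠ 0` is an eigenvalue of `x`, then for every `μ` with
`μⁿ = λⁿ + γⁿ` one has `μ_g(μ, H) ≥ μ_g(λ, x)`. -/
theorem stmt5 {N n : ℕ} (hN : 0 < N) (hn : 0 < n) {q : ℂ} (hq : IsPrimitiveRoot q n)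
    (x y : Matrix (Fin N) (Fin N) ℂ) (hxy : x * y = q • (y * x)) (hyn : y ^ n = 1)
    (γ : ℂ) (lam : ℂ) (hlam0 : lam ≠ 0) (hlam : lam ∈ spectrum ℂ x)
    (μ : ℂ) (hμ : μ ^ n = lam ^ n + γ ^ n) :
    geomMult x lam ≤ geomMult (x + γ • y) μ := by
  obtain ⟨c, ⟨k₀, hk₀, hck₀⟩, hcn, hc⟩ := aux_c hn hq γ μ lam hlam0 hμ
  have hker : ∀ (A : Matrix (Fin N) (Fin N) ℂ) (a : ℂ) (v : Fin N → ℂ),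
      v ∈ LinearMap.ker (a • (1 : Matrix (Fin N) (Fin N) ℂ) - A).mulVecLin ↔
        A *ᵥ v = a • v := by
    intro A a v
    rw [LinearMap.mem_ker, mulVecLin_apply, sub_mulVec, smul_mulVec, one_mulVec, sub_eq_zero,
      eq_comm]
  have hxyk : ∀ k : ℕ, x * y ^ k = q ^ k • (y ^ k * x) := by
    intro k
    induction k with
    | zero => simp
    | succ k ih =>
      rw [pow_succ, ← mul_assoc, ih, smul_mul_assoc, mul_assoc, hxy, mul_smul_comm, smul_smul,
        ← mul_assoc, pow_succ]
  have hxu : ∀ v : Fin N → ℂ, x *ᵥ v = lam • v → ∀ k : ℕ,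
      x *ᵥ (y ^ k *ᵥ v) = (lam * q ^ k) • (y ^ k *ᵥ v) := by
    intro v hv k
    rw [mulVec_mulVec, hxyk, smul_mulVec, ← mulVec_mulVec, hv, mulVec_smul, smul_smul, mul_comm]
  set T : Matrix (Fin N) (Fin N) ℂ := ∑ k ∈ Finset.range n, c k • y ^ k with hT
  have hTv : ∀ v : Fin N → ℂ, T *ᵥ v = ∑ k ∈ Finset.range n, c k • (y ^ k *ᵥ v) := by
    intro v
    rw [hT, sum_mulVec]
    simp only [smul_mulVec]
  have hmaps : ∀ v ∈ LinearMap.ker (lam • (1 : Matrix (Fin N) (Fin N) ℂ) - x).mulVecLin,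
      T.mulVecLin v ∈ LinearMap.ker (μ • (1 : Matrix (Fin N) (Fin N) ℂ) - (x + γ • y)).mulVecLin := by
    intro v hv
    rw [hker] at hv ⊢
    rw [mulVecLin_apply, hTv]
    have hx := hxu v hv
    have e1 : (x + γ • y) *ᵥ (∑ k ∈ Finset.range n, c k • (y ^ k *ᵥ v)) =
        ∑ k ∈ Finset.range n, (c k * (lam * q ^ k)) • (y ^ k *ᵥ v) +
        ∑ k ∈ Finset.range n, (((μ - lam * q ^ (k+1)) * c (k+1)) • (y ^ (k+1) *ᵥ v)) := by
      rw [mulVec_sum, ← Finset.sum_add_distrib]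
      refine Finset.sum_congr rfl fun k hk => ?_
      rw [hc k (Finset.mem_range.1 hk), mulVec_smul, add_mulVec, hx, smul_mulVec, mulVec_mulVec,
        ← pow_succ', smul_add, smul_smul, smul_smul, mul_comm (c k) γ]
    have e2 := Finset.sum_range_succ (fun k => ((μ - lam * q ^ k) * c k) • (y ^ k *ᵥ v)) n
    rw [Finset.sum_range_succ'] at e2
    rw [hcn, hyn, hq.pow_eq_one, pow_zero, pow_zero] at e2
    rw [e1, add_right_cancel e2, ← Finset.sum_add_distrib, Finset.smul_sum]
    refine Finset.sum_congr rfl fun k hk => ?_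
    rw [← add_smul, smul_smul]
    congr 1
    ring
  unfold geomMult
  refine LinearMap.finrank_le_finrank_of_injective (f := T.mulVecLin.restrict hmaps) ?_
  rw [injective_iff_map_eq_zero]
  rintro ⟨v, hv⟩ h0
  have h0' : T *ᵥ v = 0 := congrArg Subtype.val h0
  rw [hTv] at h0'
  rw [hker] at hv
  by_contra hne
  have hvne : v ≠ 0 := fun h => hne (Subtype.ext h)
  have hli := Module.End.eigenvectors_linearIndependent' (Matrix.mulVecLin x)
    (fun k : Fin n => lam * q ^ (k : ℕ)) (by
      intro i j hij
      exact Fin.ext (hq.pow_inj i.2 j.2 (mul_left_cancel₀ hlam0 hij)))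
    (fun k : Fin n => y ^ (k : ℕ) *ᵥ v) (by
      intro k
      refine ⟨Module.End.mem_eigenspace_iff.2 (hxu v hv k), ?_⟩
      intro h
      apply hvne
      have := congrArg (fun w => y ^ (n - (k : ℕ)) *ᵥ w) h
      simp only [mulVec_mulVec, mulVec_zero, ← pow_add, Nat.sub_add_cancel k.2.le, hyn,
        one_mulVec] at this
      exact this)
  rw [Fintype.linearIndependent_iff] at hli
  refine hck₀ (hli (fun k => c k) ?_ ⟨k₀, hk₀⟩)
  rw [← h0', Finset.sum_range]
end

section
/- Assume additionally that yⁿ = I and that x is diagonalizable and invertible. Let γ ∈ ℂ, H = x + γ y, and let λ be an eigenvalue of x with λⁿ + γⁿ = 0. Then μ_a(0, H) = n · μ_g(λ, x) = n · μ_g(0, H); that is, γ is an n-th order exceptional point of H. -/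
open Matrix

/-- The algebraic multiplicity of `μ` as an eigenvalue of `A`:
the multiplicity of `μ` as a root of the characteristic polynomial of `A`. -/
noncomputable def algMult {N : ℕ} (A : Matrix (Fin N) (Fin N) ℂ) (μ : ℂ) : ℕ :=
  (Matrix.charpoly A).rootMultiplicity μ

/-- A matrix is diagonalizable if it is similar to a diagonal matrix. -/
def Diagonalizable {N : ℕ} (A : Matrix (Fin N) (Fin N) ℂ) : Prop :=
  ∃ P : Matrix (Fin N) (Fin N) ℂ, IsUnit P ∧ (P⁻¹ * A * P).IsDiag

section aux

open Polynomial Module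

variable {V : Type*} [AddCommGroup V] [Module ℂ V] [FiniteDimensional ℂ V]

theorem aux_shift {a y z : End ℂ V} {q : ℂ} (hq0 : q ≠ 0) (hay : a * y = q • (y * a))
    (hyz : y * z = 1) (hzy : z * y = 1) (μ : ℂ) :
    finrank ℂ (LinearMap.ker (a - (q * μ) • (1 : End ℂ V))) =
      finrank ℂ (LinearMap.ker (a - μ • (1 : End ℂ V))) := by
  let e : V ≃ₗ[ℂ] V := LinearEquiv.ofLinearMap y z hyz hzy
  have h1 : ∀ v, a (y v) = q • y (a v) := fun v => by
    have := congrArg (fun f : End ℂ V => f v) hay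
    simpa using this
  have h2 : (LinearMap.ker (a - μ • (1 : End ℂ V))) =
      (LinearMap.ker (a - (q * μ) • (1 : End ℂ V))).comap (e : V →ₗ[ℂ] V) := by
    ext v
    have h3 : (a - (q * μ) • (1 : End ℂ V)) (e v) = q • e ((a - μ • (1 : End ℂ V)) v) := by
      show (a - (q * μ) • (1 : End ℂ V)) (y v) = q • y ((a - μ • (1 : End ℂ V)) v)
      simp [h1, smul_sub, mul_smul]
    rw [Submodule.mem_comap, LinearMap.mem_ker, LinearMap.mem_ker]
    show _ ↔ (a - (q * μ) • (1 : End ℂ V)) (e v) = 0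
    rw [h3, smul_eq_zero, LinearEquiv.map_eq_zero_iff]
    simp [hq0]
  rw [h2, Submodule.comap_equiv_eq_map_symm, LinearEquiv.finrank_map_eq]

theorem aux_dim {a y z : End ℂ V} {q : ℂ} {n : ℕ} (hn : 0 < n) (hq : IsPrimitiveRoot q n)
    (hay : a * y = q • (y * a))
    (hyz : y * z = 1) (hzy : z * y = 1) (μ : ℂ) (hμ : μ ≠ 0) :
    finrank ℂ (LinearMap.ker (a ^ n - (μ ^ n) • (1 : End ℂ V))) =
      n * finrank ℂ (LinearMap.ker (a - μ • (1 : End ℂ V))) := by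
  have hq0 : q ≠ 0 := hq.ne_zero hn.ne'
  have hs : ∀ j : ℕ, finrank ℂ (LinearMap.ker (aeval a (X - C (q ^ j * μ)))) =
      finrank ℂ (LinearMap.ker (a - μ • (1 : End ℂ V))) := by
    intro j
    have : aeval a (X - C (q ^ j * μ)) = a - (q ^ j * μ) • (1 : End ℂ V) := by
      rw [map_sub, aeval_X, aeval_C, Algebra.algebraMap_eq_smul_one]
    rw [this]
    clear this
    induction j with
    | zero => rw [pow_zero, one_mul]
    | succ j ih => rw [pow_succ', mul_assoc, aux_shift hq0 hay hyz hzy, ih]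
  have hk : ∀ k ≤ n, finrank ℂ (LinearMap.ker
      (aeval a (∏ j ∈ Finset.range k, (X - C (q ^ j * μ))))) =
      k * finrank ℂ (LinearMap.ker (a - μ • (1 : End ℂ V))) := by
    intro k
    induction k with
    | zero => 
      intro _
      have h0 : LinearMap.ker (1 : End ℂ V) = ⊥ := LinearMap.ker_id
      rw [Finset.range_zero, Finset.prod_empty, map_one, h0, finrank_bot, zero_mul]
    | succ k ih =>
      intro hkn
      have hc : IsCoprime (∏ j ∈ Finset.range k, (X - C (q ^ j * μ))) (X - C (q ^ k * μ)) := by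
        apply IsCoprime.prod_left
        intro i hi
        apply isCoprime_X_sub_C_of_isUnit_sub
        rw [isUnit_iff_ne_zero, sub_ne_zero]
        intro h
        have hi' := Finset.mem_range.1 hi
        have := hq.pow_inj (by omega) (by omega) (mul_right_cancel₀ hμ h)
        omega
      rw [Finset.prod_range_succ, ← sup_ker_aeval_eq_ker_aeval_mul_of_coprime a hc]
      have h2 := Submodule.finrank_sup_add_finrank_inf_eq
        (LinearMap.ker (aeval a (∏ j ∈ Finset.range k, (X - C (q ^ j * μ)))))
        (LinearMap.ker (aeval a (X - C (q ^ k * μ))))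
      rw [(disjoint_ker_aeval_of_isCoprime a hc).eq_bot, finrank_bot, ih (by omega), hs] at h2
      rw [add_mul, one_mul]
      simpa using h2
  rw [← hk n le_rfl, ← X_pow_sub_C_eq_prod hq hn rfl, map_sub, map_pow, aeval_X, aeval_C,
    Algebra.algebraMap_eq_smul_one]

theorem aux_pow {w y : End ℂ V} {q : ℂ} (hwy : w * y = q • (y * w)) (γ : ℂ) (k : ℕ) :
    (y * (w + γ • (1 : End ℂ V))) ^ k =
      y ^ k * aeval w (∏ j ∈ Finset.range k, (C γ - C q ^ j * (-X : ℂ[X]))) := by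
  have h1 : ∀ k : ℕ, w * y ^ k = q ^ k • (y ^ k * w) := by
    intro k
    induction k with
    | zero => simp
    | succ k ih =>
      rw [pow_succ, ← mul_assoc, ih, smul_mul_assoc, mul_assoc, hwy, mul_smul_comm, smul_smul,
        mul_assoc, pow_succ]
  induction k with
  | zero => simp
  | succ k ih =>
    have h2 : (w + γ • (1 : End ℂ V)) * y ^ k =
        y ^ k * aeval w (C γ - C q ^ k * (-X : ℂ[X])) := by
      rw [add_mul, h1]
      simp [Algebra.algebraMap_eq_smul_one, mul_add, add_comm, _root_.smul_pow]
    rw [pow_succ', ih, Finset.prod_range_succ, mul_comm (∏ j ∈ _, _), map_mul, mul_assoc,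
      ← mul_assoc _ (y ^ k), h2]
    simp only [pow_succ', mul_assoc]

theorem aux_pow_n {w y : End ℂ V} {q : ℂ} {n : ℕ} (hn : 0 < n) (hq : IsPrimitiveRoot q n)
    (hwy : w * y = q • (y * w)) (hyn : y ^ n = 1) (γ : ℂ) :
    (y * (w + γ • (1 : End ℂ V))) ^ n = γ ^ n • (1 : End ℂ V) - (- w) ^ n := by
  rw [aux_pow hwy, hyn, one_mul]
  have hq' : IsPrimitiveRoot (C q : ℂ[X]) n := hq.map_of_injective C_injective
  have := congrArg (Polynomial.eval (C γ)) (X_pow_sub_C_eq_prod hq' hn (α := (-X : ℂ[X])) rfl)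
  rw [eval_prod] at this
  simp only [eval_sub, eval_pow, eval_X, eval_C] at this
  rw [← this]
  simp [Algebra.algebraMap_eq_smul_one, _root_.smul_pow]

theorem aux_main {x y : End ℂ V} {q : ℂ} {n : ℕ} (hn : 0 < n) (hq : IsPrimitiveRoot q n)
    (hxy : x * y = q • (y * x)) (hyn : y ^ n = 1) (γ lam : ℂ) (hlam : lam ≠ 0)
    (hcrit : lam ^ n + γ ^ n = 0)
    (hd : ∀ k v, ((x ^ n + γ ^ n • (1 : End ℂ V)) ^ k) v = 0 →
      (x ^ n + γ ^ n • (1 : End ℂ V)) v = 0) :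
    finrank ℂ ((x + γ • y).maxGenEigenspace 0) =
        n * finrank ℂ (LinearMap.ker (x - lam • (1 : End ℂ V))) ∧
    finrank ℂ ((x + γ • y).maxGenEigenspace 0) = n * finrank ℂ (LinearMap.ker (x + γ • y)) := by
  obtain ⟨z, hyz, hzy⟩ : ∃ z, y * z = 1 ∧ z * y = 1 := by
    obtain ⟨m, rfl⟩ : ∃ m, n = m + 1 := ⟨n - 1, by omega⟩
    exact ⟨y ^ m, by rw [← pow_succ', hyn], by rw [← pow_succ, hyn]⟩
  have hwy : (z * x) * y = q • (y * (z * x)) := by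
    rw [mul_assoc, hxy, mul_smul_comm, ← mul_assoc, ← mul_assoc, hzy, hyz]
  have hH : ∀ g : ℂ, x + g • y = y * (z * x + g • (1 : End ℂ V)) := by
    intro g
    rw [mul_add, ← mul_assoc, hyz, one_mul, mul_smul_comm, mul_one]
  have hP := fun g => aux_pow_n hn hq hwy hyn g
  have hx : x ^ n = - (-(z * x)) ^ n := by
    have := hP 0
    rw [← hH] at this
    simpa [hn.ne'] using this
  have hHn : (x + γ • y) ^ n = x ^ n + γ ^ n • (1 : End ℂ V) := by
    rw [hH, hP, hx]; abel
  have hγ : γ ≠ 0 := by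
    rintro rfl
    simp [hn.ne', hlam] at hcrit
  have hgen : (x + γ • y).maxGenEigenspace 0 =
      LinearMap.ker (x ^ n + γ ^ n • (1 : End ℂ V)) := by
    ext v
    rw [Module.End.mem_maxGenEigenspace, LinearMap.mem_ker, zero_smul, sub_zero]
    constructor
    · rintro ⟨k, hk⟩
      apply hd k
      rw [← hHn, ← pow_mul, mul_comm n k]
      obtain ⟨m, rfl⟩ : ∃ m, n = m + 1 := ⟨n - 1, by omega⟩
      rw [mul_comm k, add_mul, one_mul, pow_add, Module.End.mul_apply, hk, map_zero]
    · intro h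
      exact ⟨n, by rw [hHn, h]⟩
  have e1 : x ^ n + γ ^ n • (1 : End ℂ V) = x ^ n - lam ^ n • (1 : End ℂ V) := by
    rw [eq_neg_of_add_eq_zero_left hcrit, neg_smul, sub_neg_eq_add]
  have e2 : LinearMap.ker (x ^ n + γ ^ n • (1 : End ℂ V)) =
      LinearMap.ker ((-(z * x)) ^ n - γ ^ n • (1 : End ℂ V)) := by
    rw [hx, ← LinearMap.ker_neg]
    congr 1; abel
  have e3 : LinearMap.ker (x + γ • y) = LinearMap.ker (-(z * x) - γ • (1 : End ℂ V)) := by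
    rw [hH, ← LinearMap.ker_neg (-(z * x) - _), neg_sub, sub_neg_eq_add, add_comm]
    ext v
    rw [LinearMap.mem_ker, LinearMap.mem_ker, Module.End.mul_apply]
    constructor
    · intro h
      have := congrArg z h
      rwa [← Module.End.mul_apply, hzy, map_zero] at this
    · intro h
      rw [h, map_zero]
  rw [hgen]
  constructor
  · rw [e1, aux_dim hn hq hxy hyz hzy lam hlam]
  · rw [e2, e3, aux_dim hn hq (y := y) _ hyz hzy γ hγ]
    rw [neg_mul, hwy, mul_neg, smul_neg]

end aux

theorem aux_diag {N : ℕ} (x : Matrix (Fin N) (Fin N) ℂ) (hdiag : Diagonalizable x) (n : ℕ) (c : ℂ)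
    (k : ℕ) (v : Fin N → ℂ)
    (h : ((x ^ n + c • (1 : Matrix (Fin N) (Fin N) ℂ)) ^ k) *ᵥ v = 0) :
    (x ^ n + c • (1 : Matrix (Fin N) (Fin N) ℂ)) *ᵥ v = 0 := by
  obtain ⟨P, hP, hD⟩ := hdiag
  obtain ⟨d, hd⟩ : ∃ d, P⁻¹ * x * P = Matrix.diagonal d := ⟨_, hD.diagonal_diag.symm⟩
  have hPd : IsUnit P.det := (Matrix.isUnit_iff_isUnit_det P).1 hP
  have hPP : P * P⁻¹ = 1 := Matrix.mul_nonsing_inv P hPd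
  have hPP' : P⁻¹ * P = 1 := Matrix.nonsing_inv_mul P hPd
  have conj : ∀ (A D : Matrix (Fin N) (Fin N) ℂ) (m : ℕ), P⁻¹ * A = D * P⁻¹ →
      P⁻¹ * A ^ m = D ^ m * P⁻¹ := by
    intro A D m hA
    induction m with
    | zero => simp
    | succ m ih => rw [pow_succ, ← mul_assoc, ih, mul_assoc, hA, ← mul_assoc, pow_succ]
  have h1 : P⁻¹ * x = Matrix.diagonal d * P⁻¹ := by
    rw [← hd, mul_assoc _ P, hPP, mul_one]
  have h2 : P⁻¹ * (x ^ n + c • (1 : Matrix (Fin N) (Fin N) ℂ)) =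
      Matrix.diagonal (fun i => d i ^ n + c) * P⁻¹ := by
    have : Matrix.diagonal (fun i => d i ^ n + c) =
        Matrix.diagonal d ^ n + c • (1 : Matrix (Fin N) (Fin N) ℂ) := by
      rw [Matrix.diagonal_pow, Matrix.smul_one_eq_diagonal, Matrix.diagonal_add]
      rfl
    rw [this, mul_add, conj _ _ n h1, add_mul]
    simp
  have h3 := conj _ _ k h2
  have h4 : P⁻¹ *ᵥ ((x ^ n + c • (1 : Matrix (Fin N) (Fin N) ℂ)) *ᵥ v) = 0 := by
    have h5 := congrArg (fun u => P⁻¹ *ᵥ u) h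
    simp only [Matrix.mulVec_mulVec, h3, Matrix.mulVec_zero, Matrix.diagonal_pow] at h5
    rw [← Matrix.mulVec_mulVec] at h5
    rw [Matrix.mulVec_mulVec, h2, ← Matrix.mulVec_mulVec]
    ext i
    have h6 := congrFun h5 i
    rw [Matrix.mulVec_diagonal] at h6 ⊢
    simp only [Pi.pow_apply, Pi.zero_apply, mul_eq_zero] at h6 ⊢
    exact h6.imp (fun h => by by_contra h0; exact pow_ne_zero k h0 h) id
  have := congrArg (fun u => P *ᵥ u) h4
  simpa [Matrix.mulVec_mulVec, ← mul_assoc, hPP] using this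

/-- Let `q` be a primitive n-th root of unity, `x y = q y x`, `yⁿ = 1`, and assume
`x` is diagonalizable and invertible.  If `λ` is an eigenvalue of `x` with
`λⁿ + γⁿ = 0` and `H = x + γ y`, then `μ_a(0,H) = n μ_g(λ,x) = n μ_g(0,H)`,
i.e. `γ` is an n-th order exceptional point of `H`. -/
theorem stmt8 {N n : ℕ} (hN : 0 < N) (hn : 0 < n) {q : ℂ} (hq : IsPrimitiveRoot q n)
    (x y : Matrix (Fin N) (Fin N) ℂ) (hxy : x * y = q • (y * x)) (hyn : y ^ n = 1)
    (hdiag : Diagonalizable x) (hx : IsUnit x)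
    (γ : ℂ) (lam : ℂ) (hlam : lam ∈ spectrum ℂ x) (hcrit : lam ^ n + γ ^ n = 0) :
    algMult (x + γ • y) 0 = n * geomMult x lam ∧
      algMult (x + γ • y) 0 = n * geomMult (x + γ • y) 0 := by
  have hl : lam ≠ 0 := by
    rintro rfl
    exact spectrum.zero_mem_iff ℂ |>.1 hlam hx
  let T : Matrix (Fin N) (Fin N) ℂ ≃ₐ[ℂ] ((Fin N → ℂ) →ₗ[ℂ] (Fin N → ℂ)) := Matrix.toLinAlgEquiv'
  have hT : ∀ A v, T A v = A *ᵥ v := fun A v => Matrix.toLinAlgEquiv'_apply A v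
  have key := aux_main (V := Fin N → ℂ) (x := T x) (y := T y) hn hq
    (by rw [← map_mul, hxy, map_smul, map_mul]) (by rw [← map_pow, hyn, map_one]) γ lam hl hcrit
    (by
      intro k v h
      have e : (T x) ^ n + γ ^ n • (1 : Module.End ℂ (Fin N → ℂ)) =
          T (x ^ n + γ ^ n • (1 : Matrix (Fin N) (Fin N) ℂ)) := by
        rw [map_add, map_pow, map_smul, map_one]
      rw [e, ← map_pow, hT] at h
      rw [e, hT]
      exact aux_diag x hdiag n _ k v h)
  have hH : T x + γ • T y = T (x + γ • y) := by rw [map_add, map_smul]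
  rw [hH, LinearMap.finrank_maxGenEigenspace_eq] at key
  have hc : (T (x + γ • y)).charpoly = (x + γ • y).charpoly := Matrix.charpoly_toLin' _
  rw [hc] at key
  have g1 : geomMult x lam = Module.finrank ℂ (LinearMap.ker (T x - lam • (1 : Module.End ℂ (Fin N → ℂ)))) := by
    unfold geomMult
    have : (lam • (1 : Matrix (Fin N) (Fin N) ℂ) - x).mulVecLin =
        -(T x - lam • (1 : Module.End ℂ (Fin N → ℂ))) := by
      rw [neg_sub, ← map_one T, ← map_smul, ← map_sub]; rfl
    rw [this, LinearMap.ker_neg]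
  have g2 : geomMult (x + γ • y) 0 = Module.finrank ℂ (LinearMap.ker (T (x + γ • y))) := by
    unfold geomMult
    have : ((0 : ℂ) • (1 : Matrix (Fin N) (Fin N) ℂ) - (x + γ • y)).mulVecLin =
        -(T (x + γ • y)) := by
      rw [zero_smul, zero_sub, ← map_neg]; rfl
    rw [this, LinearMap.ker_neg]
  rw [g1, g2]
  exact key
end

section
/- Let q ∈ ℂ be a primitive n-th root of unity (n a positive integer) and let x and y be N×N complex matrices with x y = q y x. Then for every γ ∈ ℂ, (x + γ y)ⁿ = xⁿ + γⁿ yⁿ. -/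
open Matrix

def gbin (q : ℂ) : ℕ → ℕ → ℂ
  | _, 0 => 1
  | 0, _ + 1 => 0
  | m + 1, k + 1 => q ^ (k + 1) * gbin q m (k + 1) + gbin q m k

lemma gbin_zero (q : ℂ) (m : ℕ) : gbin q m 0 = 1 := by cases m <;> simp [gbin]

lemma gbin_succ (q : ℂ) (m k : ℕ) :
    gbin q (m + 1) (k + 1) = q ^ (k + 1) * gbin q m (k + 1) + gbin q m k := by simp [gbin]

lemma gbin_gt (q : ℂ) (m : ℕ) : ∀ k, m < k → gbin q m k = 0 := by
  induction m with
  | zero => intro k hk; cases k with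
    | zero => omega
    | succ k => simp [gbin]
  | succ m ih => intro k hk; cases k with
    | zero => omega
    | succ k => rw [gbin_succ, ih _ (by omega), ih _ (by omega)]; simp

lemma gbin_self (q : ℂ) (m : ℕ) : gbin q m m = 1 := by
  induction m with
  | zero => simp [gbin]
  | succ m ih => rw [gbin_succ, ih, gbin_gt _ _ _ (by omega)]; simp

lemma gbin_absorb (q : ℂ) (m : ℕ) : ∀ k,
    (1 - q ^ (k + 1)) * gbin q (m + 1) (k + 1) = (1 - q ^ (m + 1)) * gbin q m k := by
  induction m with
  | zero => intro k; cases k <;> simp [gbin]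
  | succ m ih =>
    intro k
    have h1 := ih k
    have h2 := gbin_succ q (m + 1) k
    cases k with
    | zero =>
      simp only [gbin_zero] at *
      rw [h2]; linear_combination q * h1
    | succ k =>
      have h3 := ih k
      have h4 := gbin_succ q m k
      rw [h2]
      linear_combination q ^ (k + 2) * h1 - q * (1 - q ^ (m + 1)) * h4 + q * h3

lemma qcomm_pow {N : ℕ} {q : ℂ} (x z : Matrix (Fin N) (Fin N) ℂ) (h : x * z = q • (z * x))
    (k : ℕ) : x * z ^ k = q ^ k • (z ^ k * x) := by
  induction k with
  | zero => simp
  | succ k ih =>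
    rw [pow_succ z, ← mul_assoc, ih, smul_mul_assoc, mul_assoc, h, mul_smul_comm, smul_smul,
      ← pow_succ, mul_assoc]

lemma qbinomial {N : ℕ} {q : ℂ} (x z : Matrix (Fin N) (Fin N) ℂ) (h : x * z = q • (z * x))
    (m : ℕ) : (x + z) ^ m =
      ∑ k ∈ Finset.range (m + 1), gbin q m k • (z ^ k * x ^ (m - k)) := by
  induction m with
  | zero => simp [gbin]
  | succ m ih =>
    have hx : x * ∑ k ∈ Finset.range (m + 1), gbin q m k • (z ^ k * x ^ (m - k)) =
        ∑ k ∈ Finset.range (m + 1 + 1), (q ^ k * gbin q m k) • (z ^ k * x ^ (m + 1 - k)) := by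
      rw [Finset.sum_range_succ _ (m + 1), gbin_gt q m (m + 1) (by omega), mul_zero, zero_smul,
        add_zero, Finset.mul_sum]
      refine Finset.sum_congr rfl fun k hk => ?_
      have hk' : k < m + 1 := Finset.mem_range.1 hk
      rw [mul_smul_comm, ← mul_assoc, qcomm_pow x z h, smul_mul_assoc, smul_smul, mul_assoc,
        ← pow_succ', mul_comm (gbin q m k), show m - k + 1 = m + 1 - k by omega]
    rw [pow_succ', ih, add_mul, hx, Finset.sum_range_succ', Finset.sum_range_succ' _ (m + 1),
      Finset.mul_sum, add_right_comm, ← Finset.sum_add_distrib]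
    congr 1
    · refine Finset.sum_congr rfl fun k _ => ?_
      rw [gbin_succ, add_smul, mul_smul_comm, ← mul_assoc, ← pow_succ',
        show m + 1 - (k + 1) = m - k by omega]
    · simp [gbin_zero]

/-- Freshman's dream for q-commuting matrices: if `q` is a primitive n-th root of
unity and `x y = q y x`, then `(x + γ y)ⁿ = xⁿ + γⁿ yⁿ` for every `γ ∈ ℂ`. -/
theorem stmt10 {N n : ℕ} (hn : 0 < n) {q : ℂ} (hq : IsPrimitiveRoot q n)
    (x y : Matrix (Fin N) (Fin N) ℂ) (hxy : x * y = q • (y * x)) (γ : ℂ) :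
    (x + γ • y) ^ n = x ^ n + γ ^ n • y ^ n := by
  have h : x * (γ • y) = q • ((γ • y) * x) := by
    rw [mul_smul_comm, hxy, smul_mul_assoc, smul_comm]
  rw [qbinomial x _ h, ← smul_pow]
  obtain ⟨m, rfl⟩ : ∃ m, n = m + 1 := ⟨n - 1, by omega⟩
  rw [Finset.sum_range_succ, Finset.sum_range_succ', Finset.sum_eq_zero]
  · simp [gbin_zero, gbin_self]
  · intro k hk
    have hk' : k < m := Finset.mem_range.1 hk
    have h1 := gbin_absorb q m k
    rw [hq.pow_eq_one, sub_self, zero_mul] at h1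
    have h2 : q ^ (k + 1) ≠ 1 := hq.pow_ne_one_of_pos_of_lt (by omega) (by omega)
    rcases mul_eq_zero.1 h1 with h3 | h3
    · exact absurd (sub_eq_zero.1 h3).symm h2
    · rw [h3, zero_smul]
end

section
/- Let q ∈ ℂ be a primitive n-th root of unity (n a positive integer), let x and y be N×N complex matrices with x y = q y x, let γ ∈ ℂ, and set H = x + γ y. Then for every eigenvalue μ of H there exist an eigenvalue λ of x and an eigenvalue ν of y such that μⁿ = λⁿ + γⁿ νⁿ. -/
open Matrix

/-- Gaussian binomial coefficients. -/
noncomputable def gb (q : ℂ) : ℕ → ℕ → ℂ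
  | 0, 0 => 1
  | 0, _ + 1 => 0
  | m + 1, 0 => gb q m 0
  | m + 1, k + 1 => q ^ (k + 1) * gb q m (k + 1) + gb q m k

/-- q-factorial (unnormalised). -/
noncomputable def qf (q : ℂ) (m : ℕ) : ℂ := ∏ t ∈ Finset.range m, (1 - q ^ (t + 1))

lemma gb_zero (q : ℂ) (m : ℕ) : gb q m 0 = 1 := by
  induction m with
  | zero => rfl
  | succ m ih => simpa [gb] using ih

lemma gb_gt (q : ℂ) (m : ℕ) : ∀ k, m < k → gb q m k = 0 := by
  induction m with
  | zero => intro k hk; cases k with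
    | zero => omega
    | succ k => rfl
  | succ m ih => intro k hk; cases k with
    | zero => omega
    | succ k => simp [gb, ih (k + 1) (by omega), ih k (by omega)]

lemma qf_succ (q : ℂ) (m : ℕ) : qf q (m + 1) = qf q m * (1 - q ^ (m + 1)) := by
  simp [qf, Finset.prod_range_succ]

lemma gb_self (q : ℂ) (m : ℕ) : gb q m m = 1 := by
  induction m with
  | zero => rfl
  | succ m ih => simp [gb, gb_gt q m (m + 1) (by omega), ih]

lemma gb_qf (q : ℂ) (m : ℕ) : ∀ i j, i + j = m → gb q m j * (qf q i * qf q j) = qf q m := by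
  induction m with
  | zero =>
    intro i j h
    obtain ⟨rfl, rfl⟩ : i = 0 ∧ j = 0 := by omega
    simp [gb, qf]
  | succ m ih =>
    intro i j h
    cases j with
    | zero =>
      obtain rfl : i = m + 1 := by omega
      simp [gb_zero, qf]
    | succ j =>
      cases i with
      | zero =>
        obtain rfl : j = m := by omega
        simp [gb_self]
        simp [qf]
      | succ i =>
        have h1 := ih i (j + 1) (by omega)
        have h2 := ih (i + 1) j (by omega)
        obtain rfl : m = i + j + 1 := by omega
        rw [qf_succ q (i + j + 1)]
        rw [qf_succ q j] at h1 ⊢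
        rw [qf_succ q i] at h2 ⊢
        rw [show gb q (i + j + 1 + 1) (j + 1) = q ^ (j + 1) * gb q (i + j + 1) (j + 1)
          + gb q (i + j + 1) j from rfl]
        linear_combination (q ^ (j + 1) * (1 - q ^ (i + 1))) * h1 + (1 - q ^ (j + 1)) * h2

lemma qf_ne {q : ℂ} {n : ℕ} (hq : IsPrimitiveRoot q n) (m : ℕ) (hm : m < n) : qf q m ≠ 0 := by
  rw [qf, Finset.prod_ne_zero_iff]
  intro t ht
  rw [Finset.mem_range] at ht
  exact sub_ne_zero.2 (hq.pow_ne_one_of_pos_of_lt (by omega) (by omega)).symm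

lemma gb_vanish {q : ℂ} {n : ℕ} (hq : IsPrimitiveRoot q n) (k : ℕ) (h0 : 0 < k) (hk : k < n) :
    gb q n k = 0 := by
  have h := gb_qf q n (n - k) k (by omega)
  have hn : qf q n = 0 := by
    obtain ⟨m, rfl⟩ : ∃ m, n = m + 1 := ⟨n - 1, by omega⟩
    rw [qf_succ, hq.pow_eq_one]; simp
  rw [hn] at h
  exact (mul_eq_zero.1 h).resolve_right
    (mul_ne_zero (qf_ne hq _ (by omega)) (qf_ne hq _ hk))

section
variable {R : Type*} [Ring R] [Algebra ℂ R]

lemma qcomm {q : ℂ} {x z : R} (h : x * z = q • (z * x)) (k : ℕ) :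
    x * z ^ k = q ^ k • (z ^ k * x) := by
  induction k with
  | zero => simp
  | succ k ih =>
    rw [pow_succ, ← mul_assoc, ih, smul_mul_assoc, mul_assoc, h, mul_smul_comm, smul_smul,
      ← pow_succ, mul_assoc]

lemma qbinom {q : ℂ} {x z : R} (h : x * z = q • (z * x)) (m : ℕ) :
    (x + z) ^ m = ∑ k ∈ Finset.range (m + 1), gb q m k • (z ^ k * x ^ (m - k)) := by
  induction m with
  | zero => simp [gb]
  | succ m ih =>
    rw [pow_succ', ih, add_mul, Finset.mul_sum, Finset.mul_sum]
    have e1 : ∀ k ∈ Finset.range (m + 1), x * (gb q m k • (z ^ k * x ^ (m - k)))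
        = (q ^ k * gb q m k) • (z ^ k * x ^ (m + 1 - k)) := by
      intro k hk
      rw [Finset.mem_range] at hk
      rw [mul_smul_comm, ← mul_assoc, qcomm h, smul_mul_assoc, smul_smul, mul_assoc, ← pow_succ',
        mul_comm, show m + 1 - k = m - k + 1 by omega]
    have e2 : ∀ k ∈ Finset.range (m + 1), z * (gb q m k • (z ^ k * x ^ (m - k)))
        = gb q m k • (z ^ (k + 1) * x ^ (m + 1 - (k + 1))) := by
      intro k hk
      rw [mul_smul_comm, ← mul_assoc, ← pow_succ', Nat.add_sub_add_right]
    rw [Finset.sum_congr rfl e1, Finset.sum_congr rfl e2]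
    have e3 : ∑ k ∈ Finset.range (m + 1), (q ^ k * gb q m k) • (z ^ k * x ^ (m + 1 - k))
        = ∑ k ∈ Finset.range (m + 1 + 1), (q ^ k * gb q m k) • (z ^ k * x ^ (m + 1 - k)) := by
      rw [Finset.sum_range_succ _ (m + 1), gb_gt q m (m + 1) (by omega)]; simp
    rw [e3, Finset.sum_range_succ' _ (m + 1), Finset.sum_range_succ' _ (m + 1), add_right_comm,
      ← Finset.sum_add_distrib]
    simp only [gb, add_smul, pow_zero, one_mul]

lemma qfrob {q : ℂ} {n : ℕ} (hn : 0 < n) (hq : IsPrimitiveRoot q n) {x z : R}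
    (h : x * z = q • (z * x)) : (x + z) ^ n = x ^ n + z ^ n := by
  rw [qbinom h, Finset.sum_range_succ, gb_self]
  obtain ⟨m, rfl⟩ : ∃ m, n = m + 1 := ⟨n - 1, by omega⟩
  rw [Finset.sum_range_succ', Finset.sum_eq_zero]
  · simp [gb_zero]
  · intro k hk
    rw [Finset.mem_range] at hk
    rw [gb_vanish hq (k + 1) (by omega) (by omega), zero_smul]

lemma commpow {q : ℂ} {n : ℕ} (hq : IsPrimitiveRoot q n) {x y : R}
    (h : x * y = q • (y * x)) : Commute (x ^ n) (y ^ n) := by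
  have h1 : Commute x (y ^ n) := by
    have := qcomm h n
    rwa [hq.pow_eq_one, one_smul] at this
  exact h1.pow_left n
end

lemma specadd {V : Type*} [AddCommGroup V] [Module ℂ V] [FiniteDimensional ℂ V]
    (f g : Module.End ℂ V) (hfg : Commute f g) (μ : ℂ) (hμ : μ ∈ spectrum ℂ (f + g)) :
    ∃ a ∈ spectrum ℂ f, ∃ b ∈ spectrum ℂ g, μ = a + b := by
  rw [← Module.End.hasEigenvalue_iff_mem_spectrum] at hμ
  have hm : ∀ v ∈ Module.End.eigenspace (f + g) μ, f v ∈ Module.End.eigenspace (f + g) μ := by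
    intro v hv
    rw [Module.End.mem_eigenspace_iff] at hv ⊢
    have hc : Commute (f + g) f := (Commute.refl f).add_left hfg.symm
    have := congrArg (fun t : Module.End ℂ V => t v) hc.eq
    simp only [Module.End.mul_apply] at this
    rw [this, hv, map_smul]
  haveI : Nontrivial (Module.End.eigenspace (f + g) μ) :=
    Submodule.nontrivial_iff_ne_bot.2 hμ
  obtain ⟨a, ha⟩ := Module.End.exists_eigenvalue (f.restrict hm)
  obtain ⟨v, hv⟩ := ha.exists_hasEigenvector
  have hv1 : f v = a • (v : V) := by
    have := congrArg Subtype.val hv.apply_eq_smul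
    simpa using this
  have hv0 : (v : V) ≠ 0 := fun h => hv.2 (Subtype.ext h)
  have hv2 : (f + g) (v : V) = μ • (v : V) := Module.End.mem_eigenspace_iff.1 v.2
  refine ⟨a, ?_, μ - a, ?_, by ring⟩
  · exact (Module.End.hasEigenvalue_of_hasEigenvector
      (Module.End.hasEigenvector_iff.2 ⟨Module.End.mem_eigenspace_iff.2 hv1, hv0⟩)).mem_spectrum
  · refine (Module.End.hasEigenvalue_of_hasEigenvector
      (Module.End.hasEigenvector_iff.2 ⟨Module.End.mem_eigenspace_iff.2 ?_, hv0⟩)).mem_spectrum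
    rw [LinearMap.add_apply, hv1] at hv2
    rw [sub_smul, ← hv2]; abel

/-- If `q` is a primitive n-th root of unity, `x y = q y x` and `H = x + γ y`, then
for every eigenvalue `μ` of `H` there exist eigenvalues `λ` of `x` and `ν` of `y`
with `μⁿ = λⁿ + γⁿ νⁿ`. -/
theorem stmt12 {N n : ℕ} (hN : 0 < N) (hn : 0 < n) {q : ℂ} (hq : IsPrimitiveRoot q n)
    (x y : Matrix (Fin N) (Fin N) ℂ) (hxy : x * y = q • (y * x)) (γ : ℂ) :
    ∀ μ ∈ spectrum ℂ (x + γ • y), ∃ lam ∈ spectrum ℂ x, ∃ ν ∈ spectrum ℂ y,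
      μ ^ n = lam ^ n + γ ^ n * ν ^ n := by
  intro μ hμ
  haveI : Nonempty (Fin N) := ⟨⟨0, hN⟩⟩
  have hz : x * (γ • y) = q • ((γ • y) * x) := by
    rw [mul_smul_comm, hxy, smul_mul_assoc, smul_comm]
  have h1 : μ ^ n ∈ spectrum ℂ (x ^ n + (γ • y) ^ n) := by
    rw [← qfrob hn hq hz]
    exact spectrum.pow_mem_pow _ n hμ
  rw [← Matrix.spectrum_toLin', map_add] at h1
  have hc : Commute (Matrix.toLin' (x ^ n)) (Matrix.toLin' ((γ • y) ^ n)) := by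
    have := (commpow hq hz).eq
    change _ * _ = _ * _
    rw [Module.End.mul_eq_comp, Module.End.mul_eq_comp, ← Matrix.toLin'_mul, ← Matrix.toLin'_mul,
      this]
  obtain ⟨a, ha, b, hb, hab⟩ := specadd _ _ hc _ h1
  rw [Matrix.spectrum_toLin', spectrum.map_pow_of_pos _ hn] at ha
  rw [Matrix.spectrum_toLin', spectrum.map_pow_of_pos _ hn] at hb
  obtain ⟨l, hl, rfl⟩ := ha
  obtain ⟨w, hw, rfl⟩ := hb
  rw [spectrum.smul_eq_smul _ _ (spectrum.nonempty_of_isAlgClosed_of_finiteDimensional ℂ y)] at hw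
  obtain ⟨ν, hν, rfl⟩ := hw
  refine ⟨l, hl, ν, hν, ?_⟩
  rw [hab]
  simp [mul_pow]
end

section
/- Let q ∈ ℂ and let x and y be invertible N×N complex matrices with x y = q y x, let γ ∈ ℂ, and set H = x + γ y. Then (x y⁻¹) H (y x⁻¹) = q H; consequently, for every λ ∈ ℂ, λ is an eigenvalue of H if and only if qλ is an eigenvalue of H. -/
open Matrix

/-- If `x` and `y` are invertible with `x y = q y x` and `H = x + γ y`, then
`(x y⁻¹) H (y x⁻¹) = q H`; consequently `λ` is an eigenvalue of `H` iff `qλ` is. -/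
theorem stmt13 {N : ℕ} (q : ℂ) (x y : Matrix (Fin N) (Fin N) ℂ)
    (hx : IsUnit x) (hy : IsUnit y) (hxy : x * y = q • (y * x)) (γ : ℂ) :
    (x * y⁻¹) * (x + γ • y) * (y * x⁻¹) = q • (x + γ • y) ∧
      ∀ lam : ℂ, lam ∈ spectrum ℂ (x + γ • y) ↔ q * lam ∈ spectrum ℂ (x + γ • y) := by
  have hx' := (Matrix.isUnit_iff_isUnit_det x).1 hx
  have hy' := (Matrix.isUnit_iff_isUnit_det y).1 hy
  have key : (x * y⁻¹) * (x + γ • y) * (y * x⁻¹) = q • (x + γ • y) := by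
    have h1 : (x * y⁻¹) * x * (y * x⁻¹) = q • x := by
      calc (x * y⁻¹) * x * (y * x⁻¹) = x * y⁻¹ * (x * y) * x⁻¹ := by simp only [mul_assoc]
        _ = q • (x * (y⁻¹ * y) * (x * x⁻¹)) := by
          rw [hxy]; simp only [mul_assoc, Matrix.mul_smul, Matrix.smul_mul]
        _ = q • x := by
          rw [Matrix.nonsing_inv_mul _ hy', Matrix.mul_nonsing_inv _ hx', mul_one, mul_one]
    have h2 : (x * y⁻¹) * y * (y * x⁻¹) = q • y := by
      calc (x * y⁻¹) * y * (y * x⁻¹) = x * (y⁻¹ * y) * y * x⁻¹ := by simp only [mul_assoc]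
        _ = (x * y) * x⁻¹ := by rw [Matrix.nonsing_inv_mul _ hy', mul_one]
        _ = q • (y * (x * x⁻¹)) := by rw [hxy, Matrix.smul_mul, mul_assoc]
        _ = q • y := by rw [Matrix.mul_nonsing_inv _ hx', mul_one]
    rw [mul_add, add_mul, Matrix.mul_smul, Matrix.smul_mul, h1, h2, smul_add, smul_comm]
  refine ⟨key, fun lam => ?_⟩
  by_cases hq : q = 0
  · have h0 : x * y = 0 := by rw [hxy, hq, zero_smul]
    have hu : IsUnit (0 : Matrix (Fin N) (Fin N) ℂ) := h0 ▸ hx.mul hy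
    have : Subsingleton (Matrix (Fin N) (Fin N) ℂ) :=
      subsingleton_of_zero_eq_one (isUnit_zero_iff.1 hu)
    simp [spectrum.of_subsingleton]
  · have hinv : (x * y⁻¹) * (y * x⁻¹) = 1 := by
      calc (x * y⁻¹) * (y * x⁻¹) = x * (y⁻¹ * y) * x⁻¹ := by simp only [mul_assoc]
        _ = 1 := by rw [Matrix.nonsing_inv_mul _ hy', mul_one, Matrix.mul_nonsing_inv _ hx']
    let u : (Matrix (Fin N) (Fin N) ℂ)ˣ :=
      ⟨x * y⁻¹, y * x⁻¹, hinv, mul_eq_one_comm.1 hinv⟩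
    have hs : spectrum ℂ (q • (x + γ • y)) = spectrum ℂ (x + γ • y) := by
      rw [← key]
      exact spectrum.units_conjugate (u := u)
    have h3 := spectrum.smul_mem_smul_iff (a := x + γ • y) (s := lam) (r := Units.mk0 q hq)
    have h4 : q * lam ∈ spectrum ℂ (q • (x + γ • y)) ↔ lam ∈ spectrum ℂ (x + γ • y) := h3
    rw [← h4, hs]
end

section
/- Let n > 2 be an integer, q ∈ ℂ a primitive n-th root of unity, and let x and y be invertible N×N complex matrices with x y = q y x; let γ ∈ ℂ and H = x + γ y. If H has a nonzero eigenvalue, then H has an eigenvalue whose imaginary part is nonzero. -/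
open Matrix

/-- Let `n > 2`, `q` a primitive n-th root of unity, `x`, `y` invertible with
`x y = q y x`, and `H = x + γ y`.  If `H` has a nonzero eigenvalue, then `H` has an
eigenvalue with nonzero imaginary part. -/
theorem stmt14 {N n : ℕ} (hn : 2 < n) {q : ℂ} (hq : IsPrimitiveRoot q n)
    (x y : Matrix (Fin N) (Fin N) ℂ) (hx : IsUnit x) (hy : IsUnit y)
    (hxy : x * y = q • (y * x)) (γ : ℂ)
    (hnz : ∃ μ ∈ spectrum ℂ (x + γ • y), μ ≠ 0) :
    ∃ μ ∈ spectrum ℂ (x + γ • y), μ.im ≠ 0 := by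
  obtain ⟨X, rfl⟩ := hx
  obtain ⟨Y, rfl⟩ := hy
  obtain ⟨μ, hμ, hμ0⟩ := hnz
  have hq0 : q ≠ 0 := hq.ne_zero (by omega)
  have h1 : ((Y⁻¹ : (Matrix (Fin N) (Fin N) ℂ)ˣ) : Matrix (Fin N) (Fin N) ℂ) * X
      = q • ((X : Matrix (Fin N) (Fin N) ℂ) * (Y⁻¹ : (Matrix (Fin N) (Fin N) ℂ)ˣ)) := by
    rw [Units.inv_mul_eq_iff_eq_mul, mul_smul_comm, ← mul_assoc, ← smul_mul_assoc, ← hxy,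
      Units.mul_inv_cancel_right]
  have hconj : ((Y⁻¹ * X : (Matrix (Fin N) (Fin N) ℂ)ˣ) : Matrix (Fin N) (Fin N) ℂ)
      * ((X : Matrix (Fin N) (Fin N) ℂ) + γ • (Y : Matrix (Fin N) (Fin N) ℂ))
      * ((Y⁻¹ * X)⁻¹ : (Matrix (Fin N) (Fin N) ℂ)ˣ)
      = (Units.mk0 q hq0) • ((X : Matrix (Fin N) (Fin N) ℂ) + γ • (Y : Matrix (Fin N) (Fin N) ℂ)) := by
    rw [Units.mul_inv_eq_iff_eq_mul, Units.smul_def, Units.val_mk0, Units.val_mul, mul_add,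
      smul_mul_assoc, add_mul, smul_add]
    congr 1
    · rw [h1, smul_mul_assoc, mul_assoc, h1]
    · rw [mul_smul_comm, mul_assoc, hxy, smul_mul_assoc, mul_smul_comm,
        Units.inv_mul_cancel_left, Units.mul_inv_cancel_left, smul_comm]
  have hspec := congrArg (spectrum ℂ) hconj
  rw [spectrum.units_conjugate, spectrum.unit_smul_eq_smul] at hspec
  have hqμ : q * μ ∈ spectrum ℂ ((X : Matrix (Fin N) (Fin N) ℂ) + γ • (Y : Matrix (Fin N) (Fin N) ℂ)) := by
    rw [hspec]
    exact Set.smul_mem_smul_set hμ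
  by_contra! hcon
  have a := hcon _ hμ
  have b := hcon _ hqμ
  have hre : μ.re ≠ 0 := fun h => hμ0 (Complex.ext h a)
  have hqi : q.im = 0 := by
    rw [Complex.mul_im, a, mul_zero, zero_add] at b
    exact (mul_eq_zero.mp b).resolve_right hre
  have hnorm : ‖q‖ = 1 := hq.norm'_eq_one (by omega)
  have hsq : q ^ 2 = 1 := by
    have h2 : q.re * q.re = 1 := by
      have := Complex.normSq_eq_norm_sq q
      rw [hnorm, Complex.normSq_apply, hqi] at this
      linarith
    apply Complex.ext <;> simp [pow_two, hqi, h2]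
  have := Nat.le_of_dvd (by norm_num) (hq.dvd_of_pow_eq_one 2 hsq)
  omega
end

section
/- Let x and y be N×N complex matrices with x y = −y x and x invertible, and let η be an invertible Hermitian N×N matrix with η x = x† η and η y = y† η. Let γ ∈ ℝ, H = x + iγ y, and let m be an odd positive integer. Then η x^m is Hermitian and invertible and satisfies (η x^m) H = H† (η x^m); that is, η x^m is a metric operator rendering H pseudo-Hermitian. -/
open Matrix

/-- Let `x y = −y x` with `x` invertible, and let `η` be an invertible Hermitian
matrix with `η x = xᴴ η` and `η y = yᴴ η`.  For `γ ∈ ℝ`, `H = x + iγ y`, and odd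
positive `m`, the matrix `η x^m` is Hermitian, invertible, and satisfies
`(η x^m) H = Hᴴ (η x^m)`: it is a metric operator rendering `H` pseudo-Hermitian. -/
theorem stmt15 {N : ℕ} (x y η : Matrix (Fin N) (Fin N) ℂ)
    (hxy : x * y = -(y * x)) (hx : IsUnit x)
    (hη : η.IsHermitian) (hηu : IsUnit η)
    (hηx : η * x = xᴴ * η) (hηy : η * y = yᴴ * η)
    (γ : ℝ) (m : ℕ) (hm : Odd m) (hm0 : 0 < m) :
    (η * x ^ m).IsHermitian ∧ IsUnit (η * x ^ m) ∧
      (η * x ^ m) * (x + (Complex.I * (γ : ℂ)) • y) =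
        (x + (Complex.I * (γ : ℂ)) • y)ᴴ * (η * x ^ m) := by
  have h1 : η * x ^ m = xᴴ ^ m * η :=
    (show SemiconjBy η x xᴴ from hηx).pow_right m
  have h2 : x ^ m * y = -(y * x ^ m) := by
    obtain ⟨k, rfl⟩ := hm
    have hc : Commute (x ^ 2) y := by
      show x ^ 2 * y = y * x ^ 2
      rw [pow_two, mul_assoc, hxy, mul_neg, ← mul_assoc, hxy, neg_mul, neg_neg, mul_assoc]
    have hk : (x ^ 2) ^ k * y = y * (x ^ 2) ^ k := hc.pow_left k
    rw [pow_succ, pow_mul, mul_assoc, hxy, mul_neg, ← mul_assoc, hk, mul_assoc]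
  refine ⟨?_, hηu.mul (hx.pow m), ?_⟩
  · unfold Matrix.IsHermitian
    rw [conjTranspose_mul, conjTranspose_pow, hη.eq, h1]
  · have e1 : η * x ^ m * x = xᴴ * (η * x ^ m) := by
      rw [mul_assoc, ← pow_succ, pow_succ', ← mul_assoc, hηx, mul_assoc]
    have e2 : η * x ^ m * y = -(yᴴ * (η * x ^ m)) := by
      rw [mul_assoc, h2, mul_neg, ← mul_assoc, hηy, mul_assoc]
    have hc : star (Complex.I * (γ : ℂ)) = -(Complex.I * (γ : ℂ)) := by
      simp
    rw [mul_add, mul_smul_comm, e1, e2, conjTranspose_add, conjTranspose_smul, hc, add_mul,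
      smul_mul_assoc, smul_neg, neg_smul]
end

section
/- Let T and χ be N×N complex matrices with χ² = I and T χ = −χ T, let γ ∈ ℝ, and set H = T + iγχ. Then: (i) { z² : z is an eigenvalue of H } = { λ² − γ² : λ is an eigenvalue of T }; and (ii) if ψ ≠ 0 satisfies T ψ = 0 and χ ψ = s ψ with s ∈ {+1, −1}, then H ψ = i s γ ψ, so i s γ is an eigenvalue of H. -/
open Matrix

/-- Let `χ² = 1`, `T χ = −χ T`, `γ ∈ ℝ`, `H = T + iγχ`.  Then
(i) `{ z² : z ∈ sp(H) } = { λ² − γ² : λ ∈ sp(T) }`, and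
(ii) if `ψ ≠ 0` satisfies `T ψ = 0` and `χ ψ = s ψ` with `s ∈ {1, −1}`, then
`H ψ = isγ ψ`, so `isγ` is an eigenvalue of `H`. -/
theorem stmt18 {N : ℕ} (hN : 0 < N) (T χ : Matrix (Fin N) (Fin N) ℂ)
    (hχ : χ ^ 2 = 1) (hTχ : T * χ = -(χ * T)) (γ : ℝ) :
    ((fun z : ℂ => z ^ 2) '' spectrum ℂ (T + (Complex.I * (γ : ℂ)) • χ) =
      (fun lam : ℂ => lam ^ 2 - (γ : ℂ) ^ 2) '' spectrum ℂ T) ∧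
    ∀ ψ : Fin N → ℂ, ∀ s : ℂ, ψ ≠ 0 → s = 1 ∨ s = -1 →
      T.mulVec ψ = 0 → χ.mulVec ψ = s • ψ →
      (T + (Complex.I * (γ : ℂ)) • χ).mulVec ψ = (Complex.I * s * (γ : ℂ)) • ψ ∧
        Complex.I * s * (γ : ℂ) ∈ spectrum ℂ (T + (Complex.I * (γ : ℂ)) • χ) := by
  have hχ' : χ * χ = 1 := by rw [← pow_two, hχ]
  refine ⟨?_, ?_⟩
  · have hsq : (T + (Complex.I * (γ : ℂ)) • χ) ^ 2
        = Polynomial.aeval T (Polynomial.X ^ 2 - Polynomial.C ((γ : ℂ) ^ 2)) := by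
      have h1 : (Complex.I * (γ : ℂ)) * (Complex.I * (γ : ℂ)) = -(γ : ℂ) ^ 2 := by
        linear_combination (γ : ℂ) ^ 2 * Complex.I_mul_I
      rw [map_sub, map_pow, Polynomial.aeval_X, Polynomial.aeval_C, Algebra.algebraMap_eq_smul_one,
        pow_two, pow_two T, add_mul, mul_add, mul_add, smul_mul_assoc, smul_mul_assoc,
        mul_smul_comm, mul_smul_comm, smul_smul, h1, hχ', hTχ, smul_neg, neg_smul]
      abel
    rw [← spectrum.map_pow_of_pos (𝕜 := ℂ) _ (by norm_num : 0 < 2), hsq,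
      spectrum.map_polynomial_aeval_of_degree_pos]
    · simp
    · rw [Polynomial.degree_X_pow_sub_C (by norm_num)]
      norm_num
  · intro ψ s hψ _ hT hs
    have h : (T + (Complex.I * (γ : ℂ)) • χ).mulVec ψ = (Complex.I * s * (γ : ℂ)) • ψ := by
      rw [Matrix.add_mulVec, Matrix.smul_mulVec, hT, hs, zero_add, smul_smul]
      congr 1
      ring
    refine ⟨h, ?_⟩
    rw [← Matrix.spectrum_toLin']
    apply Module.End.HasEigenvalue.mem_spectrum
    apply Module.End.hasEigenvalue_of_hasEigenvector (x := ψ)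
    refine ⟨?_, hψ⟩
    rw [Module.End.mem_eigenspace_iff, Matrix.toLin'_apply, h]
end
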